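/- Let ((a,b),(c,d)) be a matrix in SL₂(ℤ) and (λ,μ) ∈ ℤ². For (τ,z) ∈ D' such that the transformed point (τ',z') = ((aτ+b)/(cτ+d), (z+λτ+μ)/(cτ+d)) also lies in D', one has J₁(τ',z') = (cτ+d)(J₁(τ,z) − λ) + c(z+λτ+μ). -/

import Mathlib

noncomputable section

open Complex MeasureTheory Set
open scoped ComplexConjugate

/-- `e w = exp (2 π i w)`. -/
def e (w : ℂ) : ℂ := Complex.exp (2 * (Real.pi : ℂ) * Complex.I * w)

/-- The monomial `q^n ζ^r`, i.e. `(τ, z) ↦ e^{2πi(nτ + rz)}`. -/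
def Qmon (n : ℕ) (r : ℤ) (τ z : ℂ) : ℂ := e ((n : ℂ) * τ + (r : ℂ) * z)

/-- `σ₁(n)`, the sum of the positive divisors of `n`. -/
def sigma1 (n : ℕ) : ℕ := ∑ d ∈ n.divisors, d

/-- The weight-2 Eisenstein series `E₂(τ) = 1 - 24 ∑_{n ≥ 1} σ₁(n) e^{2πinτ}`. -/
def E2 (τ : ℂ) : ℂ := 1 - 24 * ∑' n : ℕ, (sigma1 (n + 1) : ℂ) * e (((n : ℂ) + 1) * τ)

/-- The deformed Eisenstein series
`J₁(τ,z) = ζ/(ζ-1) - 1/2 - ∑_{a,b ≥ 1} (ζ^a - ζ^{-a}) q^{ab}`. -/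
def J1 (τ z : ℂ) : ℂ :=
  e z / (e z - 1) - 1 / 2 -
    ∑' p : ℕ × ℕ, (e (((p.1 : ℂ) + 1) * z) - e (-(((p.1 : ℂ) + 1) * z))) *
      e (((p.1 : ℂ) + 1) * ((p.2 : ℂ) + 1) * τ)

/-- The deformed Eisenstein series
`J₂(τ,z) = 1/6 - 2 ∑_{a,b ≥ 1} b (ζ^a + ζ^{-a}) q^{ab}`. -/
def J2 (τ z : ℂ) : ℂ :=
  1 / 6 - 2 * ∑' p : ℕ × ℕ, ((p.2 : ℂ) + 1) *
      (e (((p.1 : ℂ) + 1) * z) + e (-(((p.1 : ℂ) + 1) * z))) *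
      e (((p.1 : ℂ) + 1) * ((p.2 : ℂ) + 1) * τ)

/-- `D_τ = (1/2πi) ∂/∂τ`. -/
def Dt (φ : ℂ → ℂ → ℂ) : ℂ → ℂ → ℂ :=
  fun τ z => (1 / (2 * (Real.pi : ℂ) * Complex.I)) * deriv (fun t => φ t z) τ

/-- `D_z = (1/2πi) ∂/∂z`. -/
def Dz (φ : ℂ → ℂ → ℂ) : ℂ → ℂ → ℂ :=
  fun τ z => (1 / (2 * (Real.pi : ℂ) * Complex.I)) * deriv (fun w => φ τ w) z

/-- The slash action `φ ↦ φ|_{k,m} γ` for `γ = ((a,b;c,d),(λ,μ)) ∈ Γ^J`. -/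
def slash (k m : ℤ) (a b c d lam mu : ℤ) (φ : ℂ → ℂ → ℂ) (τ z : ℂ) : ℂ :=
  ((c : ℂ) * τ + (d : ℂ)) ^ (-k) *
    e ((m : ℂ) * (-(c : ℂ) * (z + (lam : ℂ) * τ + (mu : ℂ)) ^ 2 / ((c : ℂ) * τ + (d : ℂ)) +
        (lam : ℂ) ^ 2 * τ + 2 * (lam : ℂ) * z)) *
    φ (((a : ℂ) * τ + (b : ℂ)) / ((c : ℂ) * τ + (d : ℂ)))
      ((z + (lam : ℂ) * τ + (mu : ℂ)) / ((c : ℂ) * τ + (d : ℂ)))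

/-- The domain `D' = {(τ,z) : 0 < Im τ, |Im z| < Im τ, e^{2πiz} ≠ 1}`. -/
def D' : Set (ℂ × ℂ) := {p | 0 < p.1.im ∧ |p.2.im| < p.1.im ∧ e p.2 ≠ 1}

/-- The Oberdieck derivative `Oφ = D_τφ - (k/12)E₂φ - J₁D_zφ + mJ₂φ` of weight `k`, index `m`. -/
def Ober (k m : ℕ) (φ : ℂ → ℂ → ℂ) : ℂ → ℂ → ℂ :=
  fun τ z => Dt φ τ z - ((k : ℂ) / 12) * E2 τ * φ τ z - J1 τ z * Dz φ τ z +
    (m : ℂ) * J2 τ z * φ τ z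

/-- The heat operator `L_m = 4m D_τ - D_z²`. -/
def Heat (m : ℕ) (φ : ℂ → ℂ → ℂ) : ℂ → ℂ → ℂ :=
  fun τ z => 4 * (m : ℂ) * Dt φ τ z - Dz (Dz φ) τ z

/-- The modified heat operator `L_{k,m} = L_m - (m(2k-1)/6) E₂`. -/
def HeatE (k m : ℕ) (φ : ℂ → ℂ → ℂ) : ℂ → ℂ → ℂ :=
  fun τ z => Heat m φ τ z - (m : ℂ) * (2 * (k : ℂ) - 1) / 6 * E2 τ * φ τ z

/-- The Jacobi–Serre derivative of weight `k` and index `m`. -/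
def JSerre (k m : ℕ) (φ : ℂ → ℂ → ℂ) : ℂ → ℂ → ℂ :=
  fun τ z => Dt φ τ z - ((k : ℂ) / 12) * E2 τ * φ τ z +
    (1 / (1 - 4 * (m : ℂ))) *
      (Dz (Dz φ) τ z - J1 τ z * Dz φ τ z + (m : ℂ) * J2 τ z * φ τ z -
        ((m : ℂ) / 6) * E2 τ * φ τ z)

/-- The error function `erf a = (2/√π) ∫₀^a e^{-t²} dt`. -/
def erf (a : ℝ) : ℝ := 2 / Real.sqrt Real.pi * ∫ t in (0 : ℝ)..a, Real.exp (-t ^ 2)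

/-- Euler's integral for `₂F₁(1/2, k+1; 3/2; x)`:
`F_k(x) = (1/2) ∫₀¹ t^{-1/2} (1 - xt)^{-(k+1)} dt`. -/
def Fk (k x : ℝ) : ℝ := (1 / 2) * ∫ t in (0 : ℝ)..1, t ^ (-(1 : ℝ) / 2) * (1 - x * t) ^ (-(k + 1))

/-- The integration region `(u,v,x,y) ∈ [0,1] × (0,∞) × [0,1] × ℝ`. -/
def Reg : Set (ℝ × ℝ × ℝ × ℝ) := Icc 0 1 ×ˢ Ioi 0 ×ˢ Icc 0 1 ×ˢ univ

/-- The Fourier series `φ(τ,z) = ∑_{n,r} c(n,r) q^n ζ^r`. -/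
def phiF (c : ℕ → ℤ → ℂ) (τ z : ℂ) : ℂ :=
  ∑' p : ℕ × ℤ, c p.1 p.2 * e ((p.1 : ℂ) * τ + (p.2 : ℂ) * z)

theorem e_add (w v : ℂ) : e (w + v) = e w * e v := by
  simp only [e, mul_add, Complex.exp_add]

theorem e_neg (w : ℂ) : e (-w) = (e w)⁻¹ := by
  simp only [e, mul_neg, Complex.exp_neg]

theorem e_ne_zero (w : ℂ) : e w ≠ 0 := Complex.exp_ne_zero _

theorem e_nat_mul (n : ℕ) (w : ℂ) : e (n * w) = e w ^ n := by
  rw [e, e, ← Complex.exp_nat_mul]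
  congr 1
  ring

theorem e_eq_one_iff {w : ℂ} : e w = 1 ↔ ∃ n : ℤ, w = n := by
  rw [e, Complex.exp_eq_one_iff]
  refine exists_congr fun n => ?_
  rw [mul_comm (n : ℂ)]
  exact mul_right_inj' Complex.two_pi_I_ne_zero

theorem e_intCast (n : ℤ) : e n = 1 := e_eq_one_iff.2 ⟨n, rfl⟩

theorem norm_e (w : ℂ) : ‖e w‖ = Real.exp (-(2 * Real.pi * w.im)) := by
  rw [e, Complex.norm_exp]
  congr 1
  simp [Complex.mul_re, Complex.mul_im]

theorem norm_e_lt_one {w : ℂ} (hw : 0 < w.im) : ‖e w‖ < 1 := by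
  rw [norm_e, Real.exp_lt_one_iff]
  have := Real.pi_pos
  have : 0 < 2 * Real.pi * w.im := by positivity
  linarith

theorem e_ne_one {w : ℂ} (hw : 0 < w.im) : e w ≠ 1 := fun h => by
  simpa [h] using norm_e_lt_one hw

theorem differentiable_e : Differentiable ℂ e := by
  unfold e
  fun_prop

/-- The odd, `1`-periodic function `(1/2) (e w + 1) / (e w - 1)`, which vanishes at integers. -/
def cotE (w : ℂ) : ℂ := (e w + 1) / (e w - 1) / 2

/-- The rational function `ζ / (ζ - 1)` evaluated at `ζ = e w`. -/
def geomE (w : ℂ) : ℂ := e w / (e w - 1)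

theorem cotE_neg (w : ℂ) : cotE (-w) = -cotE w := by
  rw [cotE, cotE, e_neg]
  by_cases h : e w = 1
  · simp [h]
  · have h1 : e w - 1 ≠ 0 := sub_ne_zero.2 h
    have h2 : 1 - e w ≠ 0 := sub_ne_zero.2 (Ne.symm h)
    have h3 : (e w)⁻¹ - 1 ≠ 0 := by
      rw [sub_ne_zero]
      simpa using h
    have := e_ne_zero w
    field_simp
    ring

theorem cotE_eq_geomE {w : ℂ} (h : e w ≠ 1) : cotE w = geomE w - 1 / 2 := by
  have h1 : e w - 1 ≠ 0 := sub_ne_zero.2 h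
  rw [cotE, geomE]
  field_simp
  ring

theorem cotE_add_intCast (w : ℂ) (n : ℤ) : cotE (w + n) = cotE w := by
  rw [cotE, cotE, e_add, e_intCast, mul_one]

theorem differentiableAt_cotE {w : ℂ} (h : e w ≠ 1) : DifferentiableAt ℂ cotE w :=
  ((differentiable_e.differentiableAt.add_const 1).div
    (differentiable_e.differentiableAt.sub_const 1) (sub_ne_zero.2 h)).div_const 2

theorem norm_geomE_le {w : ℂ} {δ : ℝ} (hδ : 0 < δ) (hw : δ ≤ w.im) :
    ‖geomE w‖ ≤ ‖e w‖ / (1 - Real.exp (-(2 * Real.pi * δ))) := by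
  have hπ := Real.pi_pos
  have h1 : ‖e w‖ ≤ Real.exp (-(2 * Real.pi * δ)) := by
    rw [norm_e, Real.exp_le_exp]
    nlinarith
  have h2 : Real.exp (-(2 * Real.pi * δ)) < 1 := by
    rw [Real.exp_lt_one_iff]
    nlinarith
  have h3 : 1 - ‖e w‖ ≤ ‖e w - 1‖ := by
    have := norm_sub_norm_le 1 (e w)
    rwa [norm_one, norm_sub_rev] at this
  rw [geomE, norm_div]
  gcongr
  linarith

/-- The pair of terms of index `±(n + 1)` in the Eisenstein summation of `cotE (z + n τ)`. -/
def cotPair (τ z : ℂ) (n : ℕ) : ℂ := cotE (z + (n + 1) * τ) + cotE (z - (n + 1) * τ)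

theorem im_natCast_mul (τ : ℂ) (n : ℕ) : (((n : ℂ) + 1) * τ).im = (n + 1) * τ.im := by
  simp [Complex.mul_im]

theorem cotPair_eq {τ z : ℂ} {n : ℕ} (h : |z.im| < (n + 1) * τ.im) :
    cotPair τ z n = geomE (z + (n + 1) * τ) - geomE (-z + (n + 1) * τ) := by
  obtain ⟨h1, h2⟩ := abs_lt.1 h
  have e1 : e (z + (n + 1) * τ) ≠ 1 := e_ne_one (by rw [add_im, im_natCast_mul]; linarith)
  have e2 : e (-z + (n + 1) * τ) ≠ 1 := e_ne_one (by rw [add_im, neg_im, im_natCast_mul]; linarith)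
  rw [cotPair, show z - (n + 1) * τ = -(-z + (n + 1) * τ) by ring, cotE_neg, cotE_eq_geomE e1,
    cotE_eq_geomE e2]
  ring

theorem norm_cotPair_le {τ z : ℂ} {n : ℕ} {δ ρ : ℝ} (hδ : 0 < δ) (hz : |z.im| ≤ ρ)
    (h : ρ + δ ≤ (n + 1) * τ.im) :
    ‖cotPair τ z n‖ ≤ ‖e τ‖ ^ n * (2 * Real.exp (2 * Real.pi * (ρ - τ.im)) /
      (1 - Real.exp (-(2 * Real.pi * δ)))) := by
  have key : ∀ w : ℂ, |w.im| ≤ ρ → ‖geomE (w + (n + 1) * τ)‖ ≤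
      ‖e τ‖ ^ n * Real.exp (2 * Real.pi * (ρ - τ.im)) / (1 - Real.exp (-(2 * Real.pi * δ))) := by
    intro w hw
    have hw' := (abs_le.1 hw).1
    have hπ := Real.pi_pos
    have h2 : Real.exp (-(2 * Real.pi * δ)) < 1 := by
      rw [Real.exp_lt_one_iff]
      nlinarith
    refine (norm_geomE_le hδ (by rw [add_im, im_natCast_mul]; linarith)).trans ?_
    refine div_le_div_of_nonneg_right ?_ (by linarith)
    rw [norm_e, norm_e, ← Real.exp_nat_mul, ← Real.exp_add, Real.exp_le_exp, add_im,
      im_natCast_mul]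
    nlinarith
  rw [cotPair_eq (by linarith)]
  refine (norm_sub_le _ _).trans ((add_le_add (key z hz) (key (-z) (by simpa using hz))).trans
    (le_of_eq ?_))
  ring

theorem summable_norm_e_pow {τ : ℂ} (hτ : 0 < τ.im) : Summable fun n : ℕ => ‖e τ‖ ^ n :=
  summable_geometric_of_lt_one (norm_nonneg _) (norm_e_lt_one hτ)

theorem summable_cotPair {τ : ℂ} (hτ : 0 < τ.im) (z : ℂ) : Summable (cotPair τ z) := by
  refine Summable.of_norm_bounded_eventually_nat
    (((summable_norm_e_pow hτ).mul_right (2 * Real.exp (2 * Real.pi * (|z.im| - τ.im)) /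
      (1 - Real.exp (-(2 * Real.pi * 1)))))) ?_
  have : Filter.Tendsto (fun n : ℕ => ((n : ℝ) + 1) * τ.im) Filter.atTop Filter.atTop :=
    (Filter.tendsto_atTop_add_const_right _ _ tendsto_natCast_atTop_atTop).atTop_mul_const hτ
  filter_upwards [this.eventually_ge_atTop (|z.im| + 1)] with n hn
  exact norm_cotPair_le one_pos le_rfl hn

/-- The meromorphic continuation of `J1 τ` to the complex plane, by Eisenstein summation. -/
def J1ext (τ z : ℂ) : ℂ := cotE z + ∑' n : ℕ, cotPair τ z n

theorem J1ext_neg (τ z : ℂ) : J1ext τ (-z) = -J1ext τ z := by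
  have (n : ℕ) : cotPair τ (-z) n = -cotPair τ z n := by
    rw [cotPair, cotPair, show -z + (n + 1) * τ = -(z - (n + 1) * τ) by ring,
      show -z - (n + 1) * τ = -(z + (n + 1) * τ) by ring, cotE_neg, cotE_neg]
    ring
  simp only [J1ext, this, cotE_neg, tsum_neg]
  ring

theorem J1ext_add_intCast (τ z : ℂ) (m : ℤ) : J1ext τ (z + m) = J1ext τ z := by
  have (n : ℕ) : cotPair τ (z + m) n = cotPair τ z n := by
    rw [cotPair, cotPair, show z + m + (n + 1) * τ = z + (n + 1) * τ + m by ring,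
      show z + m - (n + 1) * τ = z - (n + 1) * τ + m by ring, cotE_add_intCast, cotE_add_intCast]
  simp only [J1ext, this, cotE_add_intCast]

theorem tendsto_cotE_add_mul {τ : ℂ} (hτ : 0 < τ.im) (z : ℂ) :
    Filter.Tendsto (fun n : ℕ => cotE (z + n * τ)) Filter.atTop (nhds (-(1 / 2))) := by
  have h : Filter.Tendsto (fun n : ℕ => e (z + n * τ)) Filter.atTop (nhds 0) := by
    simp only [e_add, e_nat_mul]
    simpa using (tendsto_pow_atTop_nhds_zero_of_norm_lt_one (norm_e_lt_one hτ)).const_mul (e z)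
  have := ((h.add_const 1).div (h.sub_const 1) (by norm_num)).div_const 2
  convert this using 2
  · rfl
  · norm_num

theorem J1ext_add_self {τ : ℂ} (hτ : 0 < τ.im) (z : ℂ) : J1ext τ (z + τ) = J1ext τ z - 1 := by
  have hs := (summable_cotPair hτ (z + τ)).sub (summable_cotPair hτ z)
  have hsum (N : ℕ) : ∑ n ∈ Finset.range N, (cotPair τ (z + τ) n - cotPair τ z n) =
      cotE (z + τ + N * τ) + cotE (-z + N * τ) - cotE (z + τ) + cotE z := by
    induction N with
    | zero => simp [cotE_neg]
    | succ N ih =>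
      rw [Finset.sum_range_succ, ih, cotPair, cotPair]
      push_cast
      rw [show z + τ - (N + 1) * τ = -(-z + N * τ) by ring,
        show z - (N + 1) * τ = -(-z + (N + 1) * τ) by ring,
        show z + (N + 1) * τ = z + τ + N * τ by ring, cotE_neg, cotE_neg]
      ring
  have hlim := (((tendsto_cotE_add_mul hτ (z + τ)).add
    (tendsto_cotE_add_mul hτ (-z))).sub_const (cotE (z + τ))).add_const (cotE z)
  simp only [← hsum] at hlim
  have := ((hs.hasSum_iff_tendsto_nat).2 hlim).tsum_eq
  rw [(summable_cotPair hτ (z + τ)).tsum_sub (summable_cotPair hτ z)] at this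
  rw [J1ext, J1ext, sub_eq_iff_eq_add.1 this]
  ring

theorem J1ext_add_intCast_mul {τ : ℂ} (hτ : 0 < τ.im) (z : ℂ) (m : ℤ) :
    J1ext τ (z + m * τ) = J1ext τ z - m := by
  induction m using Int.induction_on with
  | zero => simp
  | succ m ih =>
    push_cast at ih ⊢
    rw [add_one_mul, ← add_assoc, J1ext_add_self hτ, ih]
    ring
  | pred m ih =>
    have := J1ext_add_self hτ (z + (-(m : ℂ) - 1) * τ)
    rw [add_assoc, ← add_one_mul, sub_add_cancel] at this
    push_cast at ih ⊢
    rw [ih] at this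
    linear_combination -this

theorem J1ext_add_lattice {τ : ℂ} (hτ : 0 < τ.im) (z : ℂ) (m n : ℤ) :
    J1ext τ (z + m * τ + n) = J1ext τ z - m := by
  rw [J1ext_add_intCast, J1ext_add_intCast_mul hτ]

theorem differentiableAt_tsum_cotPair {τ z : ℂ} (hz : |z.im| < τ.im) :
    DifferentiableAt ℂ (fun w => ∑' n : ℕ, cotPair τ w n) z := by
  obtain ⟨ρ, hzρ, hρ⟩ := exists_between hz
  have hτ : 0 < τ.im := (abs_nonneg _).trans_lt hz
  have hle (n : ℕ) : τ.im ≤ (n + 1) * τ.im := by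
    have : (0 : ℝ) ≤ n := n.cast_nonneg
    nlinarith
  have hU : IsOpen {w : ℂ | |w.im| < ρ} :=
    isOpen_lt (continuous_abs.comp Complex.continuous_im) continuous_const
  refine (Complex.differentiableOn_tsum_of_summable_norm
    ((summable_norm_e_pow hτ).mul_right (2 * Real.exp (2 * Real.pi * (ρ - τ.im)) /
      (1 - Real.exp (-(2 * Real.pi * (τ.im - ρ)))))) ?_ hU ?_).differentiableAt (hU.mem_nhds hzρ)
  · intro n w hw
    obtain ⟨h1, h2⟩ := abs_lt.1 (show |w.im| < ρ from hw)
    have := hle n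
    refine DifferentiableAt.differentiableWithinAt ?_
    unfold cotPair
    refine DifferentiableAt.add ?_ ?_
    · refine (differentiableAt_cotE (e_ne_one ?_)).comp w (differentiableAt_id.add_const _)
      rw [add_im, im_natCast_mul]
      linarith
    · refine (differentiableAt_cotE fun h => ?_).comp w (differentiableAt_id.sub_const _)
      refine e_ne_one (w := -(w - (n + 1) * τ)) ?_ (by rw [e_neg, h, inv_one])
      rw [neg_im, sub_im, im_natCast_mul]
      linarith
  · intro n w hw
    exact norm_cotPair_le (sub_pos.2 hρ) (le_of_lt hw) (by linarith [hle n])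

theorem differentiableAt_J1ext {τ z : ℂ} (hτ : 0 < τ.im) (hz : ∀ m n : ℤ, z ≠ m * τ + n) :
    DifferentiableAt ℂ (J1ext τ) z := by
  set m : ℤ := ⌊z.im / τ.im⌋
  have him : (z - m * τ).im = z.im - m * τ.im := by simp [Complex.mul_im]
  have hstrip : |(z - m * τ).im| < τ.im := by
    have h1 := (le_div_iff₀ hτ).1 (Int.floor_le (z.im / τ.im))
    have h2 := (div_lt_iff₀ hτ).1 (Int.lt_floor_add_one (z.im / τ.im))
    rw [him, abs_lt]
    constructor <;> linarith
  have hne : e (z - m * τ) ≠ 1 := by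
    rw [Ne, e_eq_one_iff]
    rintro ⟨n, hn⟩
    exact hz m n (by rw [← hn]; ring)
  have hd : DifferentiableAt ℂ (J1ext τ) (z - m * τ) :=
    (differentiableAt_cotE hne).add (differentiableAt_tsum_cotPair hstrip)
  have heq : J1ext τ = fun w => J1ext τ (w - m * τ) - m := by
    funext w
    rw [← J1ext_add_intCast_mul hτ, sub_add_cancel]
  rw [heq]
  exact (hd.comp z (differentiableAt_id.sub_const _)).sub_const _

theorem tendsto_mul_J1ext {τ : ℂ} (hτ : 0 < τ.im) :
    Filter.Tendsto (fun z => z * J1ext τ z) (nhdsWithin 0 {0}ᶜ)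
      (nhds (2 * Real.pi * Complex.I)⁻¹) := by
  have hder : HasDerivAt e (2 * Real.pi * Complex.I) 0 := by
    have := ((hasDerivAt_id (0 : ℂ)).const_mul (2 * Real.pi * Complex.I)).cexp
    simp only [mul_zero, Complex.exp_zero, one_mul, mul_one, id] at this
    exact this
  have hslope := (hasDerivAt_iff_tendsto_slope.1 hder).inv₀ Complex.two_pi_I_ne_zero
  have he : Filter.Tendsto (fun z => (e z + 1) / 2) (nhdsWithin 0 {0}ᶜ) (nhds 1) := by
    have : Filter.Tendsto (fun z => (e z + 1) / 2) (nhds 0) (nhds ((e 0 + 1) / 2)) :=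
      ((differentiable_e.continuous.add continuous_const).div_const 2).tendsto 0
    rw [show (e 0 + 1) / 2 = 1 by norm_num [e]] at this
    exact this.mono_left nhdsWithin_le_nhds
  have hid : Filter.Tendsto (fun z : ℂ => z) (nhdsWithin 0 {0}ᶜ) (nhds 0) := nhdsWithin_le_nhds
  have hreg := (differentiableAt_tsum_cotPair (z := 0) (by simpa using hτ)).continuousAt.tendsto
  have hlim := (he.mul hslope).add (hid.mul (hreg.mono_left nhdsWithin_le_nhds))
  rw [one_mul, zero_mul, add_zero] at hlim
  refine hlim.congr fun z => ?_
  rw [J1ext, cotE, slope_def_field, show e 0 = 1 by simp [e], sub_zero, inv_div]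
  ring

theorem hasSum_e_mul_e {τ w : ℂ} (hτ : 0 < τ.im) (hw : 0 < (w + τ).im) :
    HasSum (fun p : ℕ × ℕ => e ((p.1 + 1) * w) * e ((p.1 + 1) * (p.2 + 1) * τ))
      (-∑' n : ℕ, geomE (w + (n + 1) * τ)) := by
  have hterm (p : ℕ × ℕ) : e ((p.1 + 1) * w) * e ((p.1 + 1) * (p.2 + 1) * τ) =
      e (w + (p.2 + 1) * τ) ^ (p.1 + 1) := by
    rw [← e_add, ← e_nat_mul]
    push_cast
    ring_nf
  simp only [hterm]
  have hlt (n : ℕ) : ‖e (w + (n + 1) * τ)‖ < 1 := by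
    refine norm_e_lt_one ?_
    rw [add_im] at hw
    rw [add_im, im_natCast_mul]
    have : (0 : ℝ) ≤ n * τ.im := by positivity
    linarith
  have hsum : Summable fun p : ℕ × ℕ => e (w + (p.2 + 1) * τ) ^ (p.1 + 1) := by
    refine Summable.of_norm_bounded (Summable.mul_of_nonneg (summable_norm_e_pow hw)
      (summable_norm_e_pow hτ) (fun _ => by positivity) (fun _ => by positivity)) ?_
    rintro ⟨m, n⟩
    have h1 : e (w + (n + 1) * τ) = e (w + τ) * e τ ^ n := by
      rw [← e_nat_mul, ← e_add]
      ring_nf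
    simp only [h1, norm_pow, norm_mul, mul_pow, ← pow_mul]
    refine mul_le_mul (pow_le_pow_of_le_one (norm_nonneg _) (norm_e_lt_one hw).le m.le_succ)
      (pow_le_pow_of_le_one (norm_nonneg _) (norm_e_lt_one hτ).le ?_) (by positivity)
      (by positivity)
    exact Nat.le_mul_of_pos_right n m.succ_pos
  convert hsum.hasSum using 1
  have hinner (n : ℕ) : ∑' m : ℕ, e (w + (n + 1) * τ) ^ (m + 1) = -geomE (w + (n + 1) * τ) := by
    simp only [pow_succ]
    rw [tsum_mul_right, tsum_geometric_of_norm_lt_one (hlt n), geomE,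
      ← neg_sub 1 (e (w + (n + 1) * τ)), div_neg, neg_neg, div_eq_inv_mul]
  rw [← (Equiv.prodComm ℕ ℕ).tsum_eq]
  refine Eq.trans ?_ (Summable.tsum_prod ((Equiv.prodComm ℕ ℕ).summable_iff.2 hsum)).symm
  simp only [Function.comp_apply, Equiv.prodComm_apply, Prod.swap_prod_mk, hinner, tsum_neg]

theorem summable_geomE {τ w : ℂ} (hτ : 0 < τ.im) (hw : 0 < (w + τ).im) :
    Summable fun n : ℕ => geomE (w + (n + 1) * τ) := by
  refine Summable.of_norm_bounded ((summable_norm_e_pow hτ).mul_left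
    (‖e (w + τ)‖ / (1 - Real.exp (-(2 * Real.pi * (w + τ).im))))) fun n => ?_
  have h1 : e (w + (n + 1) * τ) = e (w + τ) * e τ ^ n := by
    rw [← e_nat_mul, ← e_add]
    ring_nf
  refine (norm_geomE_le hw ?_).trans (le_of_eq ?_)
  · rw [add_im, add_im, im_natCast_mul]
    have : (0 : ℝ) ≤ n * τ.im := by positivity
    linarith
  · rw [h1, norm_mul, norm_pow]
    ring

theorem J1_eq_J1ext {τ z : ℂ} (h : (τ, z) ∈ D') : J1 τ z = J1ext τ z := by
  obtain ⟨hτ, hz, hne⟩ := h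
  dsimp only at hτ hz hne
  obtain ⟨h1, h2⟩ := abs_lt.1 hz
  have hp : 0 < (z + τ).im := by rw [add_im]; linarith
  have hm : 0 < (-z + τ).im := by rw [add_im, neg_im]; linarith
  have hsum := (hasSum_e_mul_e hτ hp).sub (hasSum_e_mul_e hτ hm)
  simp only [← sub_mul, mul_neg] at hsum
  have hpair (n : ℕ) : cotPair τ z n = geomE (z + (n + 1) * τ) - geomE (-z + (n + 1) * τ) := by
    refine cotPair_eq ?_
    have : (0 : ℝ) ≤ n * τ.im := by positivity
    linarith
  rw [J1, J1ext, cotE_eq_geomE hne, hsum.tsum_eq]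
  simp only [hpair]
  rw [(summable_geomE hτ hp).tsum_sub (summable_geomE hτ hm), geomE]
  ring

/-- An odd function on `ℂ` that is periodic for the lattice `ℤτ + ℤ`, holomorphic off that lattice
and with at most removable singularities on it vanishes identically. -/
theorem eq_zero_of_odd_of_periodic {τ : ℂ} (hτ : 0 < τ.im) {G : ℂ → ℂ}
    (hodd : ∀ z, G (-z) = -G z) (hper : ∀ (z : ℂ) (m n : ℤ), G (z + m * τ + n) = G z)
    (hdiff : ∀ z, (∀ m n : ℤ, z ≠ m * τ + n) → DifferentiableAt ℂ G z)
    (hzero : Filter.Tendsto (fun z => z * G z) (nhdsWithin 0 {0}ᶜ) (nhds 0)) (z : ℂ) :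
    G z = 0 := by
  have h0 : G 0 = 0 := by
    have := hodd 0
    rw [neg_zero] at this
    exact self_eq_neg.1 this
  have hnear : ∀ᶠ w in nhdsWithin (0 : ℂ) {0}ᶜ, DifferentiableAt ℂ G w := by
    have hball : Metric.ball (0 : ℂ) (min 1 τ.im) ∈ nhds (0 : ℂ) :=
      Metric.ball_mem_nhds _ (lt_min one_pos hτ)
    filter_upwards [self_mem_nhdsWithin, mem_nhdsWithin_of_mem_nhds hball] with w hw0 hw
    refine hdiff w fun m n hmn => hw0 ?_
    rw [mem_ball_zero_iff, lt_min_iff] at hw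
    have him : w.im = m * τ.im := by rw [hmn]; simp [Complex.mul_im]
    have hm : m = 0 := by
      have h1 := (Complex.abs_im_le_norm w).trans_lt hw.2
      rw [him, abs_mul, abs_of_pos hτ] at h1
      have h2 : |(m : ℝ)| < 1 := by nlinarith
      exact Int.abs_lt_one_iff.1 (by exact_mod_cast h2)
    have hn : n = 0 := by
      have h1 := hw.1
      rw [hmn, hm] at h1
      simp only [Int.cast_zero, zero_mul, zero_add, Complex.norm_intCast] at h1
      exact Int.abs_lt_one_iff.1 (by exact_mod_cast h1)
    simp [hmn, hm, hn]
  have hlittle : (fun w => G w - G 0) =o[nhdsWithin 0 {0}ᶜ] fun w => (w - 0)⁻¹ := by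
    refine (Asymptotics.isLittleO_iff_tendsto' ?_).2 ?_
    · filter_upwards [self_mem_nhdsWithin] with w hw h
      exact absurd (by simpa using h) hw
    · simpa [h0, mul_comm] using hzero
  have hlim := Complex.tendsto_limUnder_of_differentiable_on_punctured_nhds_of_isLittleO
    hnear hlittle
  set L := (nhdsWithin (0 : ℂ) {0}ᶜ).limUnder G
  have hL : L = 0 := by
    have hneg : Filter.Tendsto (fun w : ℂ => -w) (nhdsWithin 0 {0}ᶜ) (nhdsWithin 0 {0}ᶜ) := by
      refine tendsto_nhdsWithin_iff.2 ⟨?_, ?_⟩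
      · have : Filter.Tendsto (fun w : ℂ => -w) (nhds 0) (nhds 0) := by
          simpa using (continuous_neg (G := ℂ)).tendsto 0
        exact this.mono_left nhdsWithin_le_nhds
      · filter_upwards [self_mem_nhdsWithin] with w hw
        simpa using hw
    have h1 := hlim.comp hneg
    have h2 : G ∘ (fun w => -w) = fun w => -G w := funext hodd
    rw [h2] at h1
    exact self_eq_neg.1 (tendsto_nhds_unique hlim.neg h1).symm
  replace hlim : Filter.Tendsto G (nhdsWithin 0 {0}ᶜ) (nhds (G 0)) := by
    simpa only [hL, h0] using hlim
  have hd0 : DifferentiableAt ℂ G 0 :=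
    (Complex.analyticAt_of_differentiable_on_punctured_nhds_of_continuousAt hnear
      (continuousWithinAt_compl_self.1 hlim)).differentiableAt
  have hd : Differentiable ℂ G := by
    intro w
    by_cases hw : ∀ m n : ℤ, w ≠ m * τ + n
    · exact hdiff w hw
    · push Not at hw
      obtain ⟨m, n, rfl⟩ := hw
      have heq : G = fun v => G (v - (m * τ + n)) := by
        funext v
        rw [← hper (v - _) m n]
        congr 1
        ring
      rw [heq]
      refine DifferentiableAt.comp _ ?_ (differentiableAt_id.sub_const _)
      simpa using hd0
  have hbdd : Bornology.IsBounded (Set.range G) := by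
    have hK : IsCompact ((fun p : ℝ × ℝ => (p.1 : ℂ) * τ + p.2) '' (Icc 0 1 ×ˢ Icc 0 1)) :=
      (isCompact_Icc.prod isCompact_Icc).image (by fun_prop)
    refine (hK.image hd.continuous).isBounded.subset ?_
    rintro _ ⟨w, rfl⟩
    set y := w.im / τ.im
    set x := w.re - y * τ.re
    have hw : w = y * τ + x := by
      apply Complex.ext
      · simp [x]
      · simp [y, hτ.ne']
    refine ⟨_, ⟨(Int.fract y, Int.fract x), ⟨⟨Int.fract_nonneg _, (Int.fract_lt_one _).le⟩,
      ⟨Int.fract_nonneg _, (Int.fract_lt_one _).le⟩⟩, rfl⟩, ?_⟩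
    rw [← hper _ ⌊y⌋ ⌊x⌋]
    congr 1
    rw [hw]
    have hy : (y : ℂ) = ⌊y⌋ + (Int.fract y : ℝ) := by exact_mod_cast (Int.floor_add_fract y).symm
    have hx : (x : ℂ) = ⌊x⌋ + (Int.fract x : ℝ) := by exact_mod_cast (Int.floor_add_fract x).symm
    linear_combination -τ * hy - hx
  rw [hd.apply_eq_apply_of_bounded hbdd z 0, h0]

theorem J1ext_modular {a b c d : ℤ} (hdet : a * d - b * c = 1) {τ : ℂ} (hτ : 0 < τ.im)
    (hj : (c : ℂ) * τ + d ≠ 0) (hτ' : 0 < (((a : ℂ) * τ + b) / (c * τ + d)).im) (z : ℂ) :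
    J1ext ((a * τ + b) / (c * τ + d)) (z / (c * τ + d)) =
      (c * τ + d) * J1ext τ z + c * z := by
  set j : ℂ := c * τ + d with hj_def
  set τ' : ℂ := (a * τ + b) / j with hτ'_def
  have hdet' : (a : ℂ) * d - b * c = 1 := by exact_mod_cast hdet
  have hlat (m n : ℤ) : ((m : ℂ) * τ + n) / j =
      (m * d - n * c : ℤ) * τ' + (n * a - m * b : ℤ) := by
    rw [hτ'_def, div_eq_iff hj]
    push_cast
    field_simp
    rw [hj_def]
    linear_combination (-(m : ℂ) * τ - n) * hdet'
  have hlim : Filter.Tendsto (fun z => j * ((z / j) * J1ext τ' (z / j)) - j * (z * J1ext τ z) -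
      c * z * z) (nhdsWithin 0 {0}ᶜ) (nhds 0) := by
    have hdiv : Filter.Tendsto (fun z : ℂ => z / j) (nhdsWithin 0 {0}ᶜ) (nhdsWithin 0 {0}ᶜ) := by
      refine tendsto_nhdsWithin_iff.2 ⟨?_, ?_⟩
      · have : Filter.Tendsto (fun z : ℂ => z / j) (nhds 0) (nhds 0) := by
          simpa using (continuous_id.div_const j).tendsto (0 : ℂ)
        exact this.mono_left nhdsWithin_le_nhds
      · filter_upwards [self_mem_nhdsWithin] with w hw
        simpa [hj] using hw
    have hsq : Filter.Tendsto (fun z : ℂ => c * z * z) (nhdsWithin 0 {0}ᶜ) (nhds 0) := by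
      have : Filter.Tendsto (fun z : ℂ => c * z * z) (nhds 0) (nhds (c * 0 * 0)) :=
        Continuous.tendsto (by fun_prop) 0
      rw [mul_zero] at this
      exact this.mono_left nhdsWithin_le_nhds
    have := ((((tendsto_mul_J1ext hτ').comp hdiv).const_mul j).sub
      ((tendsto_mul_J1ext hτ).const_mul j)).sub hsq
    simpa using this
  have key := eq_zero_of_odd_of_periodic hτ
    (G := fun z => J1ext τ' (z / j) - j * J1ext τ z - c * z) ?_ ?_ ?_ ?_ z
  · linear_combination key
  · intro w
    simp only [neg_div, J1ext_neg]
    ring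
  · intro w m n
    simp only [J1ext_add_lattice hτ]
    rw [add_assoc, add_div, hlat, ← add_assoc, J1ext_add_lattice hτ', hj_def]
    push_cast
    ring
  · intro w hw
    refine (DifferentiableAt.sub (DifferentiableAt.comp w (differentiableAt_J1ext hτ' ?_)
      (differentiableAt_id.div_const j)) ((differentiableAt_J1ext hτ hw).const_mul j)).sub
      (differentiableAt_id.const_mul _)
    intro m n (h : w / j = m * τ' + n)
    refine hw (m * a + n * c) (m * b + n * d) ?_
    rw [div_eq_iff hj, add_mul, hτ'_def, mul_assoc, div_mul_cancel₀ _ hj] at h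
    rw [h, hj_def]
    push_cast
    ring
  · refine hlim.congr fun w => ?_
    field_simp

/-- transformation law of `J₁` under the Jacobi group. -/
theorem statement9 (a b c d lam mu : ℤ) (hdet : a * d - b * c = 1) (τ z : ℂ)
    (hmem : (τ, z) ∈ D')
    (hmem' : (((a : ℂ) * τ + (b : ℂ)) / ((c : ℂ) * τ + (d : ℂ)),
      (z + (lam : ℂ) * τ + (mu : ℂ)) / ((c : ℂ) * τ + (d : ℂ))) ∈ D') :
    J1 (((a : ℂ) * τ + (b : ℂ)) / ((c : ℂ) * τ + (d : ℂ)))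
        ((z + (lam : ℂ) * τ + (mu : ℂ)) / ((c : ℂ) * τ + (d : ℂ)))
      = ((c : ℂ) * τ + (d : ℂ)) * (J1 τ z - (lam : ℂ)) +
        (c : ℂ) * (z + (lam : ℂ) * τ + (mu : ℂ)) := by
  have hj : (c : ℂ) * τ + d ≠ 0 := by
    intro h
    simpa [h] using hmem'.1
  rw [J1_eq_J1ext hmem, J1_eq_J1ext hmem', J1ext_modular hdet hmem.1 hj hmem'.1,
    J1ext_add_lattice hmem.1]
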